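/- Fix A ∈ ℝ^{m×n} and a matrix Q ∈ ℝ^{m×k} with orthonormal columns (QᵀQ = I_k), where ℓ > k + 1 and ℓ ≤ m. Let Ψ ∈ ℝ^{ℓ×m} be a real standard normal random matrix, and define (almost surely) X := ((ΨQ)ᵀ(ΨQ))⁻¹(ΨQ)ᵀ Ψ A, i.e., X = (ΨQ)† Ψ A. Then E ‖X − QᵀA‖_F² = (k/(ℓ − k − 1)) · ‖A − QQᵀA‖_F². (Lemma A.4, second part, real case.) -/

import Mathlib

open Matrix MeasureTheory ProbabilityTheory

/-- Squared Frobenius norm of a real matrix. -/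
noncomputable def frobSq {m n : ℕ} (M : Matrix (Fin m) (Fin n) ℝ) : ℝ :=
  ∑ i, ∑ j, ‖M i j‖ ^ 2

instance matrixMeasurableSpace {t s : ℕ} : MeasurableSpace (Matrix (Fin t) (Fin s) ℝ) :=
  MeasurableSpace.pi

/-- The law of a `t × s` real standard normal matrix: the entries are independent
standard Gaussians. -/
noncomputable def gaussMatrix (t s : ℕ) : Measure (Matrix (Fin t) (Fin s) ℝ) :=
  Measure.pi fun _ : Fin t => Measure.pi fun _ : Fin s => gaussianReal 0 1

instance {t s : ℕ} : BorelSpace (Matrix (Fin t) (Fin s) ℝ) :=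
  inferInstanceAs (BorelSpace (Fin t → Fin s → ℝ))

instance {t s : ℕ} : SecondCountableTopology (Matrix (Fin t) (Fin s) ℝ) :=
  inferInstanceAs (SecondCountableTopology (Fin t → Fin s → ℝ))

instance {t s : ℕ} : IsProbabilityMeasure (gaussMatrix t s) :=
  inferInstanceAs (IsProbabilityMeasure
    (Measure.pi fun _ : Fin t => Measure.pi fun _ : Fin s => gaussianReal 0 1))

lemma trace_transpose_mul_eq_sum {t s : ℕ} (T X : Matrix (Fin t) (Fin s) ℝ) :
    (Tᵀ * X).trace = ∑ i, ∑ j, T i j * X i j := by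
  simp only [trace, diag, mul_apply, transpose_apply]
  exact Finset.sum_comm

lemma frobSq_eq_trace {t s : ℕ} (M : Matrix (Fin t) (Fin s) ℝ) :
    frobSq M = (Mᵀ * M).trace := by
  simp [trace_transpose_mul_eq_sum, frobSq, sq]

lemma frobSq_nonneg {t s : ℕ} (M : Matrix (Fin t) (Fin s) ℝ) : 0 ≤ frobSq M := by
  unfold frobSq; positivity

lemma measure_matrix_ext {t s : ℕ} {μ ν : Measure (Matrix (Fin t) (Fin s) ℝ)}
    [IsFiniteMeasure μ] [IsFiniteMeasure ν]
    (h : ∀ T : Matrix (Fin t) (Fin s) ℝ,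
      ∫ X, Complex.exp (((Tᵀ * X).trace : ℝ) * Complex.I) ∂μ
        = ∫ X, Complex.exp (((Tᵀ * X).trace : ℝ) * Complex.I) ∂ν) : μ = ν := by
  have hμ : @IsFiniteMeasure (Fin t → Fin s → ℝ) MeasurableSpace.pi μ := ‹IsFiniteMeasure μ›
  have hν : @IsFiniteMeasure (Fin t → Fin s → ℝ) MeasurableSpace.pi ν := ‹IsFiniteMeasure ν›
  refine Measure.ext_of_charFunDual (E := Fin t → Fin s → ℝ) (μ := μ) (ν := ν)
    (funext fun L => ?_)
  have hL : ∀ X : Matrix (Fin t) (Fin s) ℝ,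
      ((Matrix.of fun i j => L (Pi.single i (Pi.single j 1)))ᵀ * X).trace = L X := by
    intro X
    have hX : (X : Fin t → Fin s → ℝ)
        = ∑ i, ∑ j, X i j • Pi.single i (Pi.single j (1 : ℝ)) := by
      ext a b
      simp [Finset.sum_apply, Pi.single_apply, apply_ite, ite_apply]
    rw [trace_transpose_mul_eq_sum]
    conv_rhs => rw [hX]
    simp [mul_comm]
  have hT := h (Matrix.of fun i j => L (Pi.single i (Pi.single j 1)))
  simp_rw [hL] at hT
  exact hT

lemma integral_exp_trace_gaussMatrix {t s : ℕ} (T : Matrix (Fin t) (Fin s) ℝ) :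
    ∫ X, Complex.exp (((Tᵀ * X).trace : ℝ) * Complex.I) ∂(gaussMatrix t s)
      = Complex.exp (-((Tᵀ * T).trace : ℝ) / 2) := by
  have h1 : ∀ X : Matrix (Fin t) (Fin s) ℝ, Complex.exp (((Tᵀ * X).trace : ℝ) * Complex.I)
      = ∏ i, ∏ j, Complex.exp (T i j * X i j * Complex.I) := by
    intro X
    simp [trace_transpose_mul_eq_sum, Finset.sum_mul, Complex.exp_sum]
  simp_rw [h1]
  refine (integral_fintype_prod_eq_prod (𝕜 := ℂ) (ι := Fin t) (E := fun _ => Fin s → ℝ)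
    (fun i x => ∏ j, Complex.exp (T i j * x j * Complex.I))
    (μ := fun _ => Measure.pi fun _ : Fin s => gaussianReal 0 1)).trans ?_
  have h2 : ∀ i, ∫ x, ∏ j, Complex.exp (T i j * x j * Complex.I)
      ∂(Measure.pi fun _ : Fin s => gaussianReal 0 1)
      = ∏ j, Complex.exp (-(T i j ^ 2 : ℝ) / 2) := by
    intro i
    refine (integral_fintype_prod_eq_prod (𝕜 := ℂ) (ι := Fin s) (E := fun _ => ℝ)
      (fun j x => Complex.exp (T i j * x * Complex.I))
      (μ := fun _ => gaussianReal 0 1)).trans ?_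
    refine Finset.prod_congr rfl fun j _ => ?_
    rw [← charFun_apply_real, charFun_gaussianReal]
    simp [neg_div]
  simp_rw [h2, ← Complex.exp_sum]
  rw [trace_transpose_mul_eq_sum]
  congr 1
  simp [sq, neg_div, Finset.sum_div]

lemma measurePreserving_mul_mul {t s a b : ℕ} (L : Matrix (Fin a) (Fin t) ℝ)
    (R : Matrix (Fin s) (Fin b) ℝ) (hL : L * Lᵀ = 1) (hR : Rᵀ * R = 1) :
    MeasurePreserving (fun X => L * X * R) (gaussMatrix t s) (gaussMatrix a b) := by
  have hm : Measurable (fun X : Matrix (Fin t) (Fin s) ℝ => L * X * R) :=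
    Continuous.measurable (by fun_prop)
  refine ⟨hm, ?_⟩
  have := Measure.isProbabilityMeasure_map (μ := gaussMatrix t s) hm.aemeasurable
  refine measure_matrix_ext fun T => ?_
  rw [integral_exp_trace_gaussMatrix, integral_map hm.aemeasurable
    (Continuous.aestronglyMeasurable (by fun_prop))]
  have h1 : ∀ X : Matrix (Fin t) (Fin s) ℝ,
      (Tᵀ * (L * X * R)).trace = ((Lᵀ * T * Rᵀ)ᵀ * X).trace := by
    intro X
    simp only [transpose_mul, transpose_transpose, Matrix.mul_assoc]
    rw [trace_mul_comm R]
    simp only [Matrix.mul_assoc]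
  have h2 : ((Lᵀ * T * Rᵀ)ᵀ * (Lᵀ * T * Rᵀ)).trace = (Tᵀ * T).trace := by
    calc _ = (R * Tᵀ * (L * Lᵀ) * T * Rᵀ).trace := by
          simp only [transpose_mul, transpose_transpose, Matrix.mul_assoc]
      _ = ((Tᵀ * T) * (Rᵀ * R)).trace := by
          rw [hL, Matrix.mul_one, trace_mul_comm, trace_mul_comm _ (Rᵀ * R)]
          simp only [Matrix.mul_assoc]
      _ = _ := by rw [hR, Matrix.mul_one]
  simp_rw [h1]
  rw [integral_exp_trace_gaussMatrix, h2]

lemma measurePreserving_mul_add_mul {t s : ℕ} (P : Matrix (Fin s) (Fin s) ℝ)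
    (hP : Pᵀ = P) (hPP : P * P = P) :
    MeasurePreserving (fun p : Matrix (Fin t) (Fin s) ℝ × Matrix (Fin t) (Fin s) ℝ =>
      p.1 * P + p.2 * (1 - P)) ((gaussMatrix t s).prod (gaussMatrix t s)) (gaussMatrix t s) := by
  have hm : Measurable (fun p : Matrix (Fin t) (Fin s) ℝ × Matrix (Fin t) (Fin s) ℝ =>
      p.1 * P + p.2 * (1 - P)) := Continuous.measurable (by fun_prop)
  refine ⟨hm, ?_⟩
  have := Measure.isProbabilityMeasure_map
    (μ := (gaussMatrix t s).prod (gaussMatrix t s)) hm.aemeasurable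
  refine measure_matrix_ext fun T => ?_
  rw [integral_exp_trace_gaussMatrix, integral_map hm.aemeasurable
    (Continuous.aestronglyMeasurable (by fun_prop))]
  have hP' : (1 - P)ᵀ = 1 - P := by simp [hP]
  have hPP' : (1 - P) * (1 - P) = 1 - P := by simp [mul_sub, sub_mul, hPP]
  have key : ∀ (S : Matrix (Fin s) (Fin s) ℝ), Sᵀ = S → ∀ X : Matrix (Fin t) (Fin s) ℝ,
      (Tᵀ * (X * S)).trace = ((T * S)ᵀ * X).trace := by
    intro S hS X
    rw [transpose_mul, hS, ← Matrix.mul_assoc, trace_mul_comm, Matrix.mul_assoc]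
  have key2 : ∀ (S : Matrix (Fin s) (Fin s) ℝ), Sᵀ = S → S * S = S →
      ((T * S)ᵀ * (T * S)).trace = (Tᵀ * T * S).trace := by
    intro S hS hSS
    rw [← key S hS, Matrix.mul_assoc T, hSS, Matrix.mul_assoc]
  have h1 : ∀ p : Matrix (Fin t) (Fin s) ℝ × Matrix (Fin t) (Fin s) ℝ,
      Complex.exp (((Tᵀ * (p.1 * P + p.2 * (1 - P))).trace : ℝ) * Complex.I)
        = Complex.exp ((((T * P)ᵀ * p.1).trace : ℝ) * Complex.I)
          * Complex.exp ((((T * (1 - P))ᵀ * p.2).trace : ℝ) * Complex.I) := by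
    intro p
    rw [Matrix.mul_add, trace_add, key P hP, key _ hP', ← Complex.exp_add]
    push_cast
    ring_nf
  simp_rw [h1]
  refine (integral_prod_mul (μ := gaussMatrix t s) (ν := gaussMatrix t s)
    (fun X => Complex.exp ((((T * P)ᵀ * X).trace : ℝ) * Complex.I))
    (fun X => Complex.exp ((((T * (1 - P))ᵀ * X).trace : ℝ) * Complex.I))).trans ?_
  rw [integral_exp_trace_gaussMatrix, integral_exp_trace_gaussMatrix, ← Complex.exp_add,
    key2 P hP hPP, key2 _ hP' hPP', ← add_div, ← neg_add, ← Complex.ofReal_add, ← trace_add,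
    ← Matrix.mul_add, add_sub_cancel, Matrix.mul_one]

/-- Second moment of a linear form of a standard normal matrix. -/
lemma lintegral_trace_sq_gaussMatrix {t s : ℕ} (T : Matrix (Fin t) (Fin s) ℝ) :
    ∫⁻ X, ENNReal.ofReal ((Tᵀ * X).trace ^ 2) ∂(gaussMatrix t s)
      = ENNReal.ofReal (frobSq T) := by
  have hm : Measurable (fun X : Matrix (Fin t) (Fin s) ℝ => (Tᵀ * X).trace) :=
    Continuous.measurable (by fun_prop)
  have hT := Real.coe_toNNReal _ (frobSq_nonneg T)
  have hmap : (gaussMatrix t s).map (fun X => (Tᵀ * X).trace)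
      = gaussianReal 0 (frobSq T).toNNReal := by
    have := Measure.isProbabilityMeasure_map (μ := gaussMatrix t s) hm.aemeasurable
    refine Measure.ext_of_charFun (funext fun r => ?_)
    rw [charFun_gaussianReal, charFun_apply_real, integral_map hm.aemeasurable
      (Continuous.aestronglyMeasurable (by fun_prop))]
    have h1 : ∀ X : Matrix (Fin t) (Fin s) ℝ,
        ((r : ℂ) * ((Tᵀ * X).trace : ℝ) * Complex.I)
          = ((((r • T)ᵀ * X).trace : ℝ) * Complex.I) := by
      intro X; simp
    simp_rw [h1]
    rw [integral_exp_trace_gaussMatrix, frobSq_eq_trace]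
    congr 1
    rw [frobSq_eq_trace] at hT
    simp [hT]
    ring
  have h2 : ∫ x, x ^ 2 ∂(gaussianReal 0 (frobSq T).toNNReal) = frobSq T := by
    have := variance_fun_id_gaussianReal (μ := 0) (v := (frobSq T).toNNReal)
    rw [variance_of_integral_eq_zero (by fun_prop) (by simp)] at this
    simpa [hT] using this
  have h3 : Integrable (fun x : ℝ => x ^ 2) (gaussianReal 0 (frobSq T).toNNReal) :=
    (memLp_id_gaussianReal 2).integrable_sq
  rw [← lintegral_map (f := fun x : ℝ => ENNReal.ofReal (x ^ 2)) (by fun_prop) hm, hmap,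
    ← ofReal_integral_eq_lintegral_ofReal h3 (ae_of_all _ fun x => sq_nonneg x), h2]

lemma integral_exp_neg_mul_sq_gaussianReal {t : ℝ} (ht : 0 ≤ t) :
    ∫ x, Real.exp (-(t * x ^ 2)) ∂(gaussianReal 0 1) = (1 + 2 * t) ^ (-(1 / 2) : ℝ) := by
  rw [integral_gaussianReal_eq_integral_smul one_ne_zero]
  have h : ∀ x : ℝ, gaussianPDFReal 0 1 x • Real.exp (-(t * x ^ 2))
      = (√(2 * Real.pi))⁻¹ * Real.exp (-(t + 1 / 2) * x ^ 2) := by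
    intro x
    rw [gaussianPDFReal, smul_eq_mul, mul_assoc, ← Real.exp_add]
    simp only [NNReal.coe_one, mul_one, sub_zero]
    ring_nf
  simp_rw [h]
  rw [integral_const_mul, integral_gaussian, Real.rpow_neg (by positivity), ← Real.sqrt_eq_rpow,
    ← Real.sqrt_inv, ← Real.sqrt_inv, ← Real.sqrt_mul (by positivity)]
  congr 1
  field_simp
  ring

lemma measurable_frobSq {t s : ℕ} :
    Measurable (frobSq : Matrix (Fin t) (Fin s) ℝ → ℝ) := by
  have : (frobSq : Matrix (Fin t) (Fin s) ℝ → ℝ) = fun M => (Mᵀ * M).trace :=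
    funext frobSq_eq_trace
  rw [this]
  exact Continuous.measurable (by fun_prop)

lemma lintegral_exp_neg_mul_frobSq_gaussMatrix (d : ℕ) {t : ℝ} (ht : 0 ≤ t) :
    ∫⁻ X, ENNReal.ofReal (Real.exp (-(t * frobSq X))) ∂(gaussMatrix d 1)
      = ENNReal.ofReal ((1 + 2 * t) ^ (-((d : ℝ) / 2))) := by
  have hm : Measurable fun X : Matrix (Fin d) (Fin 1) ℝ => Real.exp (-(t * frobSq X)) :=
    ((measurable_frobSq.const_mul t).neg).exp
  have hint : Integrable (fun X : Matrix (Fin d) (Fin 1) ℝ => Real.exp (-(t * frobSq X)))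
      (gaussMatrix d 1) := by
    refine Integrable.of_bound hm.aestronglyMeasurable 1 (ae_of_all _ fun X => ?_)
    rw [Real.norm_eq_abs, Real.abs_exp, Real.exp_le_one_iff, Left.neg_nonpos_iff]
    exact mul_nonneg ht (frobSq_nonneg X)
  rw [← ofReal_integral_eq_lintegral_ofReal hint (ae_of_all _ fun X => (Real.exp_pos _).le)]
  congr 1
  have h1 : ∀ X : Matrix (Fin d) (Fin 1) ℝ, Real.exp (-(t * frobSq X))
      = ∏ i, ∏ j, Real.exp (-(t * X i j ^ 2)) := by
    intro X
    simp [frobSq, Finset.mul_sum, Real.exp_sum, ← Finset.sum_neg_distrib]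
  simp_rw [h1]
  refine (integral_fintype_prod_eq_prod (𝕜 := ℝ) (ι := Fin d) (E := fun _ => Fin 1 → ℝ)
    (fun i x => ∏ j, Real.exp (-(t * x j ^ 2)))
    (μ := fun _ => Measure.pi fun _ : Fin 1 => gaussianReal 0 1)).trans ?_
  have h2 : ∫ x, ∏ j, Real.exp (-(t * x j ^ 2))
      ∂(Measure.pi fun _ : Fin 1 => gaussianReal 0 1) = (1 + 2 * t) ^ (-(1 / 2) : ℝ) := by
    refine (integral_fintype_prod_eq_prod (𝕜 := ℝ) (ι := Fin 1) (E := fun _ => ℝ)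
      (fun j x => Real.exp (-(t * x ^ 2))) (μ := fun _ => gaussianReal 0 1)).trans ?_
    simp [integral_exp_neg_mul_sq_gaussianReal ht]
  simp_rw [h2]
  rw [Finset.prod_const, Finset.card_univ, Fintype.card_fin, ← Real.rpow_natCast,
    ← Real.rpow_mul (by positivity)]
  congr 1
  ring

lemma lintegral_exp_neg_mul_Ioi {r : ℝ} (hr : 0 ≤ r) :
    ∫⁻ t in Set.Ioi (0 : ℝ), ENNReal.ofReal (Real.exp (-(t * r))) = (ENNReal.ofReal r)⁻¹ := by
  rcases hr.eq_or_lt with rfl | hr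
  · simp
  · have hi : IntegrableOn (fun t : ℝ => Real.exp (-(t * r))) (Set.Ioi 0) := by
      simpa [mul_comm] using exp_neg_integrableOn_Ioi 0 hr
    rw [← ofReal_integral_eq_lintegral_ofReal hi (ae_of_all _ fun _ => (Real.exp_pos _).le),
      ← ENNReal.ofReal_inv_of_pos hr]
    congr 1
    have := integral_exp_mul_Ioi (neg_lt_zero.2 hr) 0
    simpa [mul_comm] using this

lemma lintegral_one_add_two_mul_rpow {d : ℕ} (hd : 3 ≤ d) :
    ∫⁻ t in Set.Ioi (0 : ℝ), ENNReal.ofReal ((1 + 2 * t) ^ (-((d : ℝ) / 2)))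
      = ENNReal.ofReal (1 / ((d : ℝ) - 2)) := by
  have hd' : (3 : ℝ) ≤ d := by exact_mod_cast hd
  have hder : ∀ x ∈ Set.Ici (0 : ℝ),
      HasDerivAt (fun t : ℝ => -(1 / ((d : ℝ) - 2)) * (1 + 2 * t) ^ (1 - (d : ℝ) / 2))
        ((1 + 2 * x) ^ (-((d : ℝ) / 2))) x := by
    intro x hx
    have hx : (0 : ℝ) ≤ x := hx
    have h1 : HasDerivAt (fun t : ℝ => 1 + 2 * t) 2 x := by
      simpa using ((hasDerivAt_id x).const_mul 2).const_add 1
    have h2 := (h1.rpow_const (p := 1 - (d : ℝ) / 2)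
      (Or.inl (by positivity))).const_mul (-(1 / ((d : ℝ) - 2)))
    refine h2.congr_deriv ?_
    have : (d : ℝ) - 2 ≠ 0 := by linarith
    rw [show 1 - (d : ℝ) / 2 - 1 = -((d : ℝ) / 2) by ring]
    field_simp
    ring
  have hlim : Filter.Tendsto
      (fun t : ℝ => -(1 / ((d : ℝ) - 2)) * (1 + 2 * t) ^ (1 - (d : ℝ) / 2))
      Filter.atTop (nhds 0) := by
    have h1 : Filter.Tendsto (fun t : ℝ => 1 + 2 * t) Filter.atTop Filter.atTop :=
      Filter.tendsto_atTop_add_const_left _ _ (Filter.tendsto_id.const_mul_atTop two_pos)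
    have h2 := (tendsto_rpow_neg_atTop (y := (d : ℝ) / 2 - 1) (by linarith)).comp h1
    simpa using h2.const_mul (-(1 / ((d : ℝ) - 2)))
  have hpos : ∀ x ∈ Set.Ioi (0 : ℝ), 0 ≤ (1 + 2 * x) ^ (-((d : ℝ) / 2)) := by
    intro x hx
    have hx : (0 : ℝ) < x := hx
    positivity
  have hi := integrableOn_Ioi_deriv_of_nonneg' hder hpos hlim
  rw [← ofReal_integral_eq_lintegral_ofReal hi
      ((ae_restrict_iff' measurableSet_Ioi).2 (ae_of_all _ hpos)),
    integral_Ioi_of_hasDerivAt_of_tendsto' hder hi hlim]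
  simp

/-- The mean of the reciprocal of a chi-squared variable with `d ≥ 3` degrees of freedom. -/
lemma lintegral_inv_frobSq_gaussMatrix {d : ℕ} (hd : 3 ≤ d) :
    ∫⁻ X, (ENNReal.ofReal (frobSq X))⁻¹ ∂(gaussMatrix d 1)
      = ENNReal.ofReal (1 / ((d : ℝ) - 2)) := by
  have hm : Measurable fun p : Matrix (Fin d) (Fin 1) ℝ × ℝ =>
      ENNReal.ofReal (Real.exp (-(p.2 * frobSq p.1))) :=
    ((measurable_snd.mul (measurable_frobSq.comp measurable_fst)).neg.exp).ennreal_ofReal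
  simp_rw [← lintegral_exp_neg_mul_Ioi (frobSq_nonneg _)]
  rw [lintegral_lintegral_swap hm.aemeasurable, ← lintegral_one_add_two_mul_rpow hd]
  exact setLIntegral_congr_fun measurableSet_Ioi fun t ht =>
    lintegral_exp_neg_mul_frobSq_gaussMatrix d (le_of_lt ht)

lemma ae_frobSq_ne_zero {d : ℕ} (hd : 3 ≤ d) : ∀ᵐ X ∂(gaussMatrix d 1), frobSq X ≠ 0 := by
  have hm : Measurable fun X : Matrix (Fin d) (Fin 1) ℝ => (ENNReal.ofReal (frobSq X))⁻¹ :=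
    measurable_frobSq.ennreal_ofReal.inv
  have hfin : ∫⁻ X, (ENNReal.ofReal (frobSq X))⁻¹ ∂(gaussMatrix d 1) ≠ ⊤ := by
    rw [lintegral_inv_frobSq_gaussMatrix hd]
    exact ENNReal.ofReal_ne_top
  filter_upwards [ae_lt_top hm hfin] with X hX h0
  simp [h0] at hX

lemma exists_complement_basis {ℓ k : ℕ} (G : Matrix (Fin ℓ) (Fin k) ℝ) (j : Fin k)
    (hG : LinearIndependent ℝ fun i : {i // i ≠ j} => Gᵀ i) :
    ∃ E : Matrix (Fin (ℓ + 1 - k)) (Fin ℓ) ℝ, E * Eᵀ = 1 ∧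
      (∀ i, i ≠ j → E *ᵥ Gᵀ i = 0) ∧
      ∀ w : Fin ℓ → ℝ, (∀ i, i ≠ j → w ⬝ᵥ Gᵀ i = 0) → Eᵀ *ᵥ (E *ᵥ w) = w := by
  set v : {i // i ≠ j} → EuclideanSpace ℝ (Fin ℓ) := fun i => WithLp.toLp 2 (Gᵀ i) with hv
  have hvi : LinearIndependent ℝ v :=
    hG.map' (WithLp.linearEquiv 2 ℝ (Fin ℓ → ℝ)).symm.toLinearMap (LinearEquiv.ker _)
  set W := Submodule.span ℝ (Set.range v) with hW
  have hcard : Module.finrank ℝ W = k - 1 := by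
    rw [hW, finrank_span_eq_card hvi]
    simp
  have hperp : Module.finrank ℝ Wᗮ = ℓ + 1 - k := by
    have h1 := Submodule.finrank_add_finrank_orthogonal W
    rw [hcard, finrank_euclideanSpace_fin] at h1
    have := j.pos
    omega
  let b := (stdOrthonormalBasis ℝ Wᗮ).reindex (finCongr hperp)
  have hbW : ∀ w : Fin ℓ → ℝ, (∀ i, i ≠ j → w ⬝ᵥ Gᵀ i = 0) → WithLp.toLp 2 w ∈ Wᗮ := by
    intro w hw
    rw [hW, Submodule.mem_orthogonal']
    intro u hu
    induction hu using Submodule.span_induction with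
    | mem x hx =>
      obtain ⟨i, rfl⟩ := hx
      have := hw i i.2
      rw [dotProduct_comm] at this
      simpa [hv, EuclideanSpace.inner_eq_star_dotProduct] using this
    | zero => simp
    | add x y _ _ hx hy => rw [inner_add_right, hx, hy, add_zero]
    | smul c x _ hx => rw [inner_smul_right, hx, mul_zero]
  let E : Matrix (Fin (ℓ + 1 - k)) (Fin ℓ) ℝ :=
    Matrix.of fun a c => (b a : EuclideanSpace ℝ (Fin ℓ)) c
  have hE : ∀ w : Fin ℓ → ℝ, ∀ a, (E *ᵥ w) a
      = inner ℝ (b a : EuclideanSpace ℝ (Fin ℓ)) (WithLp.toLp 2 w) := by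
    intro w a
    simp [E, EuclideanSpace.inner_eq_star_dotProduct, mulVec, dotProduct, mul_comm]
  refine ⟨E, ?_, ?_, ?_⟩
  · ext a c
    have h1 := orthonormal_iff_ite.1 b.orthonormal a c
    rw [Submodule.coe_inner] at h1
    rw [one_apply, ← h1]
    exact hE (E c) a
  · intro i hi
    ext a
    rw [hE, Pi.zero_apply]
    exact Submodule.inner_left_of_mem_orthogonal (K := W)
      (Submodule.subset_span ⟨⟨i, hi⟩, rfl⟩) (b a).2
  · intro w hw
    have h1 := congrArg (fun x : Wᗮ => (x : EuclideanSpace ℝ (Fin ℓ)))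
      (b.sum_repr' ⟨WithLp.toLp 2 w, hbW w hw⟩)
    ext c
    have h2 := congrArg (fun x : EuclideanSpace ℝ (Fin ℓ) => x c) h1
    simp only [Submodule.coe_inner, Submodule.coe_sum, Submodule.coe_smul] at h2
    simp only [WithLp.ofLp_sum, WithLp.ofLp_smul, Finset.sum_apply, Pi.smul_apply,
      smul_eq_mul, ← hE] at h2
    rw [← h2]
    simp [mulVec, dotProduct, E, mul_comm]

lemma det_gram_ne_zero_iff {ℓ k : ℕ} (H : Matrix (Fin ℓ) (Fin k) ℝ) :
    (Hᵀ * H).det ≠ 0 ↔ LinearIndependent ℝ Hᵀ := by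
  have h1 : (∃ v, v ≠ 0 ∧ (Hᵀ * H) *ᵥ v = 0) ↔ ∃ v, v ≠ 0 ∧ H *ᵥ v = 0 := by
    simp_rw [← Matrix.mulVecLin_apply, ← LinearMap.mem_ker, ker_mulVecLin_transpose_mul_self]
  rw [ne_eq, ← exists_mulVec_eq_zero_iff, h1]
  refine Iff.trans ?_ (mulVec_injective_iff (M := H))
  rw [← Matrix.coe_mulVecLin, injective_iff_map_eq_zero]
  simp only [Matrix.mulVecLin_apply]
  push Not
  exact forall_congr' fun v => ⟨fun h => not_imp_not.1 h, fun h => mt h⟩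

lemma gram_pinv_row {ℓ k d : ℕ} (H : Matrix (Fin ℓ) (Fin k) ℝ) (j : Fin k)
    (hH : LinearIndependent ℝ fun i : {i // i ≠ j} => Hᵀ i)
    (E : Matrix (Fin d) (Fin ℓ) ℝ)
    (hE : ∀ i, i ≠ j → E *ᵥ Hᵀ i = 0)
    (hproj : ∀ w : Fin ℓ → ℝ, (∀ i, i ≠ j → w ⬝ᵥ Hᵀ i = 0) → Eᵀ *ᵥ (E *ᵥ w) = w)
    (hne : E *ᵥ Hᵀ j ≠ 0) :
    (Hᵀ * H).det ≠ 0 ∧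
      ∑ a, (((Hᵀ * H)⁻¹ * Hᵀ) j a) ^ 2 = ((E *ᵥ Hᵀ j) ⬝ᵥ (E *ᵥ Hᵀ j))⁻¹ := by
  have hcol : ∀ v : Fin k → ℝ, H *ᵥ v = ∑ i, v i • Hᵀ i := by
    intro v
    ext a
    simp [mulVec, dotProduct, mul_comm]
  have hEH : ∀ v : Fin k → ℝ, E *ᵥ (H *ᵥ v) = v j • (E *ᵥ Hᵀ j) := by
    intro v
    rw [hcol, ← Matrix.mulVecLin_apply, map_sum, Finset.sum_eq_single j]
    · simp
    · intro i _ hi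
      simp [hE i hi]
    · simp
  have hdet : (Hᵀ * H).det ≠ 0 := by
    rw [det_gram_ne_zero_iff]
    refine (mulVec_injective_iff (M := H)).1 ?_
    rw [← Matrix.coe_mulVecLin, injective_iff_map_eq_zero]
    intro v hHv
    rw [Matrix.mulVecLin_apply] at hHv
    have hvj : v j = 0 := by
      have := hEH v
      rw [hHv, mulVec_zero] at this
      exact (smul_eq_zero.1 this.symm).resolve_right hne
    have hsum : ∑ i : {i // i ≠ j}, v i • Hᵀ i = 0 := by
      rw [← hHv, hcol, Fintype.sum_eq_add_sum_subtype_ne _ j, hvj, zero_smul, zero_add]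
    ext i
    by_cases hi : i = j
    · rw [hi, hvj, Pi.zero_apply]
    · exact Fintype.linearIndependent_iff.1 hH (fun i => v i) hsum ⟨i, hi⟩
  refine ⟨hdet, ?_⟩
  set N := (Hᵀ * H)⁻¹ with hN
  have hNs : Nᵀ = N := by
    rw [hN, transpose_nonsing_inv]; simp
  have hMH : N * Hᵀ * H = 1 := by
    rw [Matrix.mul_assoc, hN, nonsing_inv_mul _ (Ne.isUnit hdet)]
  set w : Fin ℓ → ℝ := (N * Hᵀ) j with hw
  have hwH : ∀ i, w ⬝ᵥ Hᵀ i = (1 : Matrix (Fin k) (Fin k) ℝ) j i := by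
    intro i
    rw [← hMH]; rfl
  have hwP := hproj w fun i hi => by rw [hwH, one_apply_ne hi.symm]
  have hwc : w = H *ᵥ N j := by
    ext a
    simp only [hw, mul_apply, mulVec, dotProduct, transpose_apply]
    exact Finset.sum_congr rfl fun _ _ => mul_comm _ _
  have hEw : E *ᵥ w = N j j • (E *ᵥ Hᵀ j) := by rw [hwc, hEH]
  have hw_dot : ∀ x : Fin ℓ → ℝ, w ⬝ᵥ x = (E *ᵥ w) ⬝ᵥ (E *ᵥ x) := by
    intro x
    conv_lhs => rw [← hwP]
    rw [mulVec_transpose, ← dotProduct_mulVec]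
  have h1 : N j j * ((E *ᵥ Hᵀ j) ⬝ᵥ (E *ᵥ Hᵀ j)) = 1 := by
    have := hwH j
    rwa [hw_dot, hEw, smul_dotProduct, one_apply_eq, smul_eq_mul] at this
  have h2 : ∑ a, w a ^ 2 = w ⬝ᵥ w := by simp [dotProduct, sq]
  rw [h2, hw_dot, hEw, smul_dotProduct, dotProduct_smul, smul_eq_mul, smul_eq_mul, h1, mul_one]
  exact eq_inv_of_mul_eq_one_left h1

lemma mul_diagonal_add_mul_col {ℓ k : ℕ} (j : Fin k) (G G' : Matrix (Fin ℓ) (Fin k) ℝ)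
    (i : Fin k) :
    (G * diagonal (fun i => if i = j then (0 : ℝ) else 1)
      + G' * (1 - diagonal fun i => if i = j then (0 : ℝ) else 1))ᵀ i
      = if i = j then G'ᵀ i else Gᵀ i := by
  ext a
  simp only [← diagonal_one, diagonal_sub, transpose_apply, Matrix.add_apply, mul_diagonal]
  split_ifs <;> simp [*]

/-- Replacing a column of a standard normal matrix by an independent copy preserves the law. -/
lemma measurePreserving_replace_col {ℓ k : ℕ} (j : Fin k) :
    MeasurePreserving (fun p : Matrix (Fin ℓ) (Fin k) ℝ × Matrix (Fin ℓ) (Fin k) ℝ =>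
      p.1 * diagonal (fun i => if i = j then (0 : ℝ) else 1)
        + p.2 * (1 - diagonal fun i => if i = j then (0 : ℝ) else 1))
      ((gaussMatrix ℓ k).prod (gaussMatrix ℓ k)) (gaussMatrix ℓ k) :=
  measurePreserving_mul_add_mul _ (diagonal_transpose _) (by simp [diagonal_mul_diagonal])

lemma measurable_det_gram {ℓ k : ℕ} :
    Measurable fun G : Matrix (Fin ℓ) (Fin k) ℝ => (Gᵀ * G).det :=
  Continuous.measurable (by fun_prop)

lemma measurable_gram_inv {ℓ k : ℕ} :
    Measurable fun G : Matrix (Fin ℓ) (Fin k) ℝ => (Gᵀ * G)⁻¹ := by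
  have h : ∀ G : Matrix (Fin ℓ) (Fin k) ℝ,
      (Gᵀ * G)⁻¹ = ((Gᵀ * G).det)⁻¹ • (Gᵀ * G).adjugate := by
    intro G
    rw [Matrix.inv_def, Ring.inverse_eq_inv']
  simp_rw [h]
  have h1 : Measurable fun p : ℝ × Matrix (Fin k) (Fin k) ℝ => p.1 • p.2 :=
    Continuous.measurable (by fun_prop)
  have h2 : Measurable fun G : Matrix (Fin ℓ) (Fin k) ℝ => (Gᵀ * G).adjugate :=
    Continuous.measurable (by fun_prop)
  exact h1.comp (measurable_det_gram.inv.prodMk h2)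

lemma measurable_gram_pinv {ℓ k : ℕ} :
    Measurable fun G : Matrix (Fin ℓ) (Fin k) ℝ => (Gᵀ * G)⁻¹ * Gᵀ := by
  have h1 : Measurable fun p : Matrix (Fin k) (Fin k) ℝ × Matrix (Fin ℓ) (Fin k) ℝ =>
      p.1 * p.2ᵀ := Continuous.measurable (by fun_prop)
  exact h1.comp (measurable_gram_inv.prodMk measurable_id)

lemma exists_measurePreserving_gram_pinv_row {ℓ k : ℕ} (hℓ : k + 1 < ℓ) (j : Fin k)
    (G : Matrix (Fin ℓ) (Fin k) ℝ)
    (hG : LinearIndependent ℝ fun i : {i // i ≠ j} => Gᵀ i) :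
    ∃ g : Matrix (Fin ℓ) (Fin k) ℝ → Matrix (Fin (ℓ + 1 - k)) (Fin 1) ℝ,
      MeasurePreserving g (gaussMatrix ℓ k) (gaussMatrix (ℓ + 1 - k) 1) ∧
      ∀ᵐ G' ∂(gaussMatrix ℓ k), ∀ H, (∀ i, Hᵀ i = if i = j then G'ᵀ i else Gᵀ i) →
        (Hᵀ * H).det ≠ 0 ∧
        ENNReal.ofReal (∑ a, (((Hᵀ * H)⁻¹ * Hᵀ) j a) ^ 2)
          = (ENNReal.ofReal (frobSq (g G')))⁻¹ := by
  obtain ⟨E, hEE, hE0, hEp⟩ := exists_complement_basis G j hG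
  let c : Matrix (Fin k) (Fin 1) ℝ := Matrix.of fun i _ => if i = j then 1 else 0
  have hc : cᵀ * c = 1 := by
    ext a b
    simp [c, mul_apply, one_apply, Subsingleton.elim a b]
  have hg := measurePreserving_mul_mul E c hEE hc
  have hfrob : ∀ G' : Matrix (Fin ℓ) (Fin k) ℝ,
      frobSq (E * G' * c) = (E *ᵥ G'ᵀ j) ⬝ᵥ (E *ᵥ G'ᵀ j) := by
    intro G'
    have : ∀ a b, (E * G' * c) a b = (E *ᵥ G'ᵀ j) a := by
      intro a b
      rw [mul_apply]
      simp only [c, of_apply, mul_ite, mul_one, mul_zero, Finset.sum_ite_eq', Finset.mem_univ,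
        if_true]
      rfl
    simp [frobSq, this, dotProduct, sq]
  refine ⟨fun G' => E * G' * c, hg, ?_⟩
  filter_upwards [hg.quasiMeasurePreserving.ae (ae_frobSq_ne_zero (by omega))] with G' hG' H hH
  have hHi : ∀ i, i ≠ j → Hᵀ i = Gᵀ i := fun i hi => by rw [hH, if_neg hi]
  have hHj : Hᵀ j = G'ᵀ j := by rw [hH, if_pos rfl]
  have hlin : LinearIndependent ℝ fun i : {i // i ≠ j} => Hᵀ i := by
    convert hG using 2 with i
    exact hHi i i.2
  have hpos : 0 < frobSq (E * G' * c) := lt_of_le_of_ne (frobSq_nonneg _) (Ne.symm hG')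
  obtain ⟨h1, h2⟩ := gram_pinv_row H j hlin E (fun i hi => by rw [hHi i hi, hE0 i hi])
    (fun w hw => hEp w fun i hi => by rw [← hHi i hi, hw i hi])
    (by
      intro h0
      rw [hfrob, ← hHj, h0] at hG'
      simp at hG')
  refine ⟨h1, ?_⟩
  rw [h2, hHj, ← hfrob, ENNReal.ofReal_inv_of_pos hpos]

lemma ae_det_gram_ne_zero {k : ℕ} : ∀ {ℓ : ℕ}, k + 1 < ℓ →
    ∀ᵐ G ∂(gaussMatrix ℓ k), (Gᵀ * G).det ≠ 0 := by
  induction k with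
  | zero => intro ℓ _; exact ae_of_all _ fun G => by simp
  | succ k ih =>
    intro ℓ hℓ
    let R : Matrix (Fin (k + 1)) (Fin k) ℝ :=
      Matrix.of fun i a => if i = a.castSucc then 1 else 0
    have hR : Rᵀ * R = 1 := by
      ext a b
      simp [R, mul_apply, one_apply, eq_comm]
    have hGR : ∀ (G : Matrix (Fin ℓ) (Fin (k + 1)) ℝ) (a : Fin k),
        ((1 : Matrix (Fin ℓ) (Fin ℓ) ℝ) * G * R)ᵀ a = Gᵀ a.castSucc := by
      intro G a
      ext b
      simp [R, mul_apply]
    have hred := (measurePreserving_mul_mul (1 : Matrix (Fin ℓ) (Fin ℓ) ℝ) R (by simp)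
      hR).quasiMeasurePreserving.ae (ih (ℓ := ℓ) (by omega))
    have hmp := measurePreserving_replace_col (ℓ := ℓ) (Fin.last k)
    have hset : MeasurableSet {G : Matrix (Fin ℓ) (Fin (k + 1)) ℝ | (Gᵀ * G).det ≠ 0} :=
      measurable_det_gram (measurableSet_singleton 0).compl
    rw [← hmp.map_eq, ae_map_iff hmp.measurable.aemeasurable hset]
    refine (Measure.ae_prod_iff_ae_ae (hmp.measurable hset)).2 ?_
    filter_upwards [hred] with G hG
    have hlin : LinearIndependent ℝ fun i : {i // i ≠ Fin.last k} => Gᵀ i := by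
      have h1 := (det_gram_ne_zero_iff _).1 hG
      have h2 := h1.comp (fun i : {i // i ≠ Fin.last k} => i.1.castPred i.2)
        fun a b hab => Subtype.ext (Fin.castPred_inj.1 hab)
      convert h2 using 2 with i
      exact ((hGR G (i.1.castPred i.2)).trans (by rw [Fin.castSucc_castPred])).symm
    obtain ⟨g, -, hg⟩ := exists_measurePreserving_gram_pinv_row hℓ (Fin.last k) G hlin
    filter_upwards [hg] with G' hG'
    exact (hG' _ (mul_diagonal_add_mul_col _ G G')).1

/-- The mean squared Frobenius norm of the pseudoinverse of a standard normal matrix. -/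
lemma lintegral_frobSq_gram_pinv {ℓ k : ℕ} (hℓ : k + 1 < ℓ) :
    ∫⁻ G, ENNReal.ofReal (frobSq ((Gᵀ * G)⁻¹ * Gᵀ)) ∂(gaussMatrix ℓ k)
      = ENNReal.ofReal ((k : ℝ) / ((ℓ : ℝ) - k - 1)) := by
  have hrow : ∀ j, Measurable fun G : Matrix (Fin ℓ) (Fin k) ℝ =>
      ENNReal.ofReal (∑ a, (((Gᵀ * G)⁻¹ * Gᵀ) j a) ^ 2) := by
    intro j
    have : Measurable fun M : Matrix (Fin k) (Fin ℓ) ℝ => ENNReal.ofReal (∑ a, M j a ^ 2) :=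
      (Continuous.measurable (by fun_prop)).ennreal_ofReal
    exact this.comp measurable_gram_pinv
  have hsplit : ∀ G : Matrix (Fin ℓ) (Fin k) ℝ,
      ENNReal.ofReal (frobSq ((Gᵀ * G)⁻¹ * Gᵀ))
        = ∑ j, ENNReal.ofReal (∑ a, (((Gᵀ * G)⁻¹ * Gᵀ) j a) ^ 2) := by
    intro G
    rw [← ENNReal.ofReal_sum_of_nonneg fun j _ => by positivity]
    simp [frobSq]
  have hcast : (((ℓ + 1 - k : ℕ) : ℝ)) - 2 = (ℓ : ℝ) - k - 1 := by
    rw [Nat.cast_sub (by omega)]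
    push_cast
    ring
  have hone : ∀ j, ∫⁻ G, ENNReal.ofReal (∑ a, (((Gᵀ * G)⁻¹ * Gᵀ) j a) ^ 2) ∂(gaussMatrix ℓ k)
      = ENNReal.ofReal (1 / ((ℓ : ℝ) - k - 1)) := by
    intro j
    have hmp := measurePreserving_replace_col (ℓ := ℓ) j
    have hinv : Measurable fun X : Matrix (Fin (ℓ + 1 - k)) (Fin 1) ℝ =>
        (ENNReal.ofReal (frobSq X))⁻¹ := measurable_frobSq.ennreal_ofReal.inv
    rw [← hmp.lintegral_comp (hrow j)]
    refine (lintegral_prod _ ((hrow j).comp hmp.measurable).aemeasurable).trans ?_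
    calc _ = ∫⁻ _, ENNReal.ofReal (1 / ((ℓ : ℝ) - k - 1)) ∂(gaussMatrix ℓ k) := by
          refine lintegral_congr_ae ?_
          filter_upwards [ae_det_gram_ne_zero hℓ] with G hG
          have hlin : LinearIndependent ℝ fun i : {i // i ≠ j} => Gᵀ i :=
            ((det_gram_ne_zero_iff _).1 hG).comp _ Subtype.val_injective
          obtain ⟨g, hgm, hg⟩ := exists_measurePreserving_gram_pinv_row hℓ j G hlin
          rw [← hcast, ← lintegral_inv_frobSq_gaussMatrix (d := ℓ + 1 - k) (by omega),
            ← hgm.lintegral_comp hinv]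
          refine lintegral_congr_ae ?_
          filter_upwards [hg] with G' hG'
          exact (hG' _ (mul_diagonal_add_mul_col _ G G')).2
      _ = _ := by simp
  simp_rw [hsplit]
  rw [lintegral_finsetSum _ fun j _ => hrow j]
  simp_rw [hone]
  rw [Finset.sum_const, Finset.card_univ, Fintype.card_fin, nsmul_eq_mul,
    ← ENNReal.ofReal_natCast, ← ENNReal.ofReal_mul (by positivity)]
  congr 1
  ring

lemma lintegral_frobSq_mul_mul_gaussMatrix {a t s b : ℕ} (M : Matrix (Fin a) (Fin t) ℝ)
    (B : Matrix (Fin s) (Fin b) ℝ) :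
    ∫⁻ X, ENNReal.ofReal (frobSq (M * (X * B))) ∂(gaussMatrix t s)
      = ENNReal.ofReal (frobSq M * frobSq B) := by
  have h1 : ∀ X : Matrix (Fin t) (Fin s) ℝ, ENNReal.ofReal (frobSq (M * (X * B)))
      = ∑ i, ∑ j, ENNReal.ofReal (((vecMulVec (M i) (Bᵀ j))ᵀ * X).trace ^ 2) := by
    intro X
    simp_rw [← ENNReal.ofReal_sum_of_nonneg fun j _ => sq_nonneg _]
    rw [← ENNReal.ofReal_sum_of_nonneg fun i _ => Finset.sum_nonneg fun j _ => sq_nonneg _]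
    congr 1
    unfold frobSq
    refine Finset.sum_congr rfl fun i _ => Finset.sum_congr rfl fun j _ => ?_
    rw [Real.norm_eq_abs, sq_abs, trace_transpose_mul_eq_sum]
    congr 1
    simp only [mul_apply, vecMulVec_apply, transpose_apply, Finset.mul_sum]
    exact Finset.sum_congr rfl fun p _ => Finset.sum_congr rfl fun q _ => by ring
  have hm : ∀ T : Matrix (Fin t) (Fin s) ℝ,
      Measurable fun X : Matrix (Fin t) (Fin s) ℝ => ENNReal.ofReal ((Tᵀ * X).trace ^ 2) :=
    fun T => (Continuous.measurable (by fun_prop)).ennreal_ofReal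
  simp_rw [h1]
  rw [lintegral_finsetSum _ fun i _ => Finset.measurable_fun_sum _ fun j _ => hm _]
  simp_rw [lintegral_finsetSum _ fun j _ => hm _, lintegral_trace_sq_gaussMatrix]
  simp_rw [← ENNReal.ofReal_sum_of_nonneg fun j _ => frobSq_nonneg _]
  rw [← ENNReal.ofReal_sum_of_nonneg fun i _ => Finset.sum_nonneg fun j _ => frobSq_nonneg _]
  congr 1
  have h2 : ∀ i j, frobSq (vecMulVec (M i) (Bᵀ j)) = (∑ p, M i p ^ 2) * ∑ q, B q j ^ 2 := by
    intro i j
    simp [frobSq, vecMulVec_apply, mul_pow, Finset.sum_mul_sum]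
  simp_rw [h2, ← Finset.mul_sum, ← Finset.sum_mul]
  rw [Finset.sum_comm (f := fun j q => B q j ^ 2)]
  simp [frobSq]

/-- **Lemma A.4, second part, real case.**  For a fixed `A ∈ ℝ^{m×n}` and `Q ∈ ℝ^{m×k}`
with orthonormal columns, and `Ψ ∈ ℝ^{ℓ×m}` standard normal with `ℓ > k + 1`, the matrix
`X = (ΨQ)† Ψ A = ((ΨQ)ᵀ(ΨQ))⁻¹ (ΨQ)ᵀ Ψ A` satisfies
`E ‖X - QᵀA‖_F² = (k/(ℓ-k-1)) ‖A - QQᵀA‖_F²`. -/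
theorem expect_frobSq_second_factor {m n k ℓ : ℕ} (hℓ : k + 1 < ℓ) (hℓm : ℓ ≤ m)
    (A : Matrix (Fin m) (Fin n) ℝ)
    (Q : Matrix (Fin m) (Fin k) ℝ) (hQ : Qᵀ * Q = 1) :
    ∫ Ψ, frobSq (((Ψ * Q)ᵀ * (Ψ * Q))⁻¹ * (Ψ * Q)ᵀ * (Ψ * A) - Qᵀ * A)
        ∂(gaussMatrix ℓ m)
      = ((k : ℝ) / ((ℓ : ℝ) - k - 1)) * frobSq (A - Q * (Qᵀ * A)) := by
  set F : Matrix (Fin ℓ) (Fin m) ℝ → ℝ := fun Ψ =>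
    frobSq (((Ψ * Q)ᵀ * (Ψ * Q))⁻¹ * (Ψ * Q)ᵀ * (Ψ * A) - Qᵀ * A) with hF
  set P : Matrix (Fin m) (Fin m) ℝ := Q * Qᵀ with hP
  have hPP : P * P = P := by
    rw [hP, Matrix.mul_assoc, ← Matrix.mul_assoc Qᵀ, hQ, Matrix.one_mul]
  have hPQ : P * Q = Q := by rw [hP, Matrix.mul_assoc, hQ, Matrix.mul_one]
  have hmQ := measurePreserving_mul_mul (1 : Matrix (Fin ℓ) (Fin ℓ) ℝ) Q (by simp) hQ
  simp only [Matrix.one_mul] at hmQ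
  have hFm : Measurable F := by
    have h1 : Measurable fun p : Matrix (Fin k) (Fin ℓ) ℝ × Matrix (Fin ℓ) (Fin m) ℝ =>
        p.1 * (p.2 * A) - Qᵀ * A := Continuous.measurable (by fun_prop)
    exact measurable_frobSq.comp
      (h1.comp ((measurable_gram_pinv.comp hmQ.measurable).prodMk measurable_id))
  have hmp := measurePreserving_mul_add_mul (t := ℓ) P (by simp [hP]) hPP
  have hlin : ∫⁻ Ψ, ENNReal.ofReal (F Ψ) ∂(gaussMatrix ℓ m)
      = ENNReal.ofReal ((k : ℝ) / ((ℓ : ℝ) - k - 1) * frobSq (A - Q * (Qᵀ * A))) := by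
    rw [← hmp.lintegral_comp hFm.ennreal_ofReal]
    refine (lintegral_prod _ (hFm.ennreal_ofReal.comp hmp.measurable).aemeasurable).trans ?_
    calc _ = ∫⁻ Ψ, ENNReal.ofReal (frobSq (((Ψ * Q)ᵀ * (Ψ * Q))⁻¹ * (Ψ * Q)ᵀ))
            * ENNReal.ofReal (frobSq (A - Q * (Qᵀ * A))) ∂(gaussMatrix ℓ m) := by
          refine lintegral_congr_ae ?_
          filter_upwards [hmQ.quasiMeasurePreserving.ae (ae_det_gram_ne_zero hℓ)] with Ψ hΨ
          rw [← ENNReal.ofReal_mul (frobSq_nonneg _), ← lintegral_frobSq_mul_mul_gaussMatrix]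
          refine lintegral_congr fun Ψ' => ?_
          have h1 : (Ψ * P + Ψ' * (1 - P)) * Q = Ψ * Q := by
            rw [Matrix.add_mul, Matrix.mul_assoc, hPQ, Matrix.mul_assoc, Matrix.sub_mul, hPQ,
              Matrix.one_mul, sub_self, Matrix.mul_zero, add_zero]
          have h2 : (Ψ * P + Ψ' * (1 - P)) * A
              = Ψ * Q * (Qᵀ * A) + Ψ' * (A - Q * (Qᵀ * A)) := by
            rw [Matrix.add_mul, hP]
            simp only [Matrix.mul_assoc, Matrix.sub_mul, Matrix.one_mul]
          have h3 : ((Ψ * Q)ᵀ * (Ψ * Q))⁻¹ * (Ψ * Q)ᵀ * (Ψ * Q * (Qᵀ * A)) = Qᵀ * A := by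
            rw [← Matrix.mul_assoc, Matrix.mul_assoc _ (Ψ * Q)ᵀ,
              nonsing_inv_mul _ (Ne.isUnit hΨ), Matrix.one_mul]
          simp only [hF, Function.comp_apply]
          rw [h1, h2, Matrix.mul_add, h3, add_sub_cancel_left]
      _ = _ := by
          have hm : Measurable fun G : Matrix (Fin ℓ) (Fin k) ℝ =>
              ENNReal.ofReal (frobSq ((Gᵀ * G)⁻¹ * Gᵀ)) :=
            (measurable_frobSq.comp measurable_gram_pinv).ennreal_ofReal
          have hm' : Measurable fun Ψ : Matrix (Fin ℓ) (Fin m) ℝ =>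
              ENNReal.ofReal (frobSq (((Ψ * Q)ᵀ * (Ψ * Q))⁻¹ * (Ψ * Q)ᵀ)) :=
            hm.comp hmQ.measurable
          rw [lintegral_mul_const _ hm', hmQ.lintegral_comp hm, lintegral_frobSq_gram_pinv hℓ,
            ← ENNReal.ofReal_mul]
          have : (k : ℝ) + 1 < ℓ := by exact_mod_cast hℓ
          exact div_nonneg (by positivity) (by linarith)
  rw [integral_eq_lintegral_of_nonneg_ae (ae_of_all _ fun _ => frobSq_nonneg _)
    hFm.aestronglyMeasurable, hlin, ENNReal.toReal_ofReal]
  have : (k : ℝ) + 1 < ℓ := by exact_mod_cast hℓ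
  exact mul_nonneg (div_nonneg (by positivity) (by linarith)) (frobSq_nonneg _)
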